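/- Let k be a finite field of odd cardinality and ℓ/k its quadratic field extension, with σ the nontrivial k-automorphism of ℓ. Then: (i) for (a, b) ∈ k², the pair (a, b) is ℓ-admissible if and only if a = b and 1 − a² is not a square in k; (ii) defining |x| = x if x is a square in k and |x| = −x otherwise, a triple c = (c₁, c₂, c₃) ∈ k³ is ℓ-admissible if and only if (1 − c₁)c₂ ≠ 0, 1 − 2c₁ is not a square in k, and c₃ = −c₁|c₂| / |1 − c₁|. -/

import Mathlib

open Module Function

variable {k ℓ : Type}

/-- The function `h_{a,b} : ℓ × ℓ → ℓ` associated with a pair `(a, b) ∈ k²`. -/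
def hab [Field k] [Field ℓ] [Algebra k ℓ] (σ : ℓ ≃ₐ[k] ℓ) (a b : k) (x y : ℓ) : ℓ :=
  x ^ 2 - y ^ 2 + algebraMap k ℓ a * (x * σ x) + algebraMap k ℓ b * (y * σ y)

/-- A pair `(a, b) ∈ k²` is `ℓ`-admissible if `h_{a,b}` is anisotropic. -/
def IsAdmissiblePair [Field k] [Field ℓ] [Algebra k ℓ] (σ : ℓ ≃ₐ[k] ℓ)
    (a b : k) : Prop :=
  ∀ x y : ℓ, hab σ a b x y = 0 → x = 0 ∧ y = 0

/-- The function `q_c : ℓ × ℓ → ℓ` associated with a triple `c = (c₁, c₂, c₃) ∈ k³`. -/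
def qc [Field k] [Field ℓ] [Algebra k ℓ] (σ : ℓ ≃ₐ[k] ℓ) (c : k × k × k) (x y : ℓ) : ℓ :=
  (1 - algebraMap k ℓ c.1) * x ^ 2 + algebraMap k ℓ c.1 * (x * σ x)
    - algebraMap k ℓ c.2.1 * y ^ 2 - algebraMap k ℓ c.2.2 * (y * σ y)

/-- A triple `c ∈ k³` is `ℓ`-admissible if `q_c` is anisotropic. -/
def IsAdmissibleTriple [Field k] [Field ℓ] [Algebra k ℓ] (σ : ℓ ≃ₐ[k] ℓ)
    (c : k × k × k) : Prop :=
  ∀ x y : ℓ, qc σ c x y = 0 → x = 0 ∧ y = 0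

/-- The map `|·| : k → k` with `|x| = x` if `x` is a square in `k` and `|x| = −x` otherwise. -/
noncomputable def absk [Field k] (x : k) : k := by
  classical exact if IsSquare x then x else -x

theorem two_ne_zero_of_odd_card {F : Type*} [Field F] [Fintype F] (hodd : Odd (Fintype.card F)) :
    (2 : F) ≠ 0 := by
  obtain ⟨m, hm⟩ := hodd
  have := FiniteField.cast_card_eq_zero F
  intro h
  rw [hm] at this
  push_cast at this
  simp [h] at this

section Quartic

open Polynomial

theorem X_pow_card_sub_X_dvd {F : Type*} [Field F] [Fintype F] {f : F[X]}
    (hf : ∀ u, f.eval u = 0) : X ^ Fintype.card F - X ∣ f := by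
  classical
  have hd : (X ^ Fintype.card F - X : F[X]).natDegree = Fintype.card F :=
    FiniteField.X_pow_card_sub_X_natDegree_eq F Fintype.one_lt_card
  have hm : (X ^ Fintype.card F - X : F[X]).Monic :=
    monic_X_pow_sub (by rw [degree_X]; exact_mod_cast Fintype.one_lt_card)
  rw [← modByMonic_eq_zero_iff_dvd hm]
  refine eq_zero_of_degree_lt_of_eval_finset_eq_zero (Finset.univ : Finset F) ?_ fun u _ => ?_
  · have := degree_modByMonic_lt f hm
    rwa [degree_eq_natDegree hm.ne_zero, hd] at this
  · have := congrArg (Polynomial.eval u) (modByMonic_add_div f (X ^ Fintype.card F - X))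
    simpa [FiniteField.pow_card, hf] using this

/-- A Stepanov-type argument: a polynomial of degree at most four whose values on a field with more
than six elements are all nonzero squares divides the square of its derivative. -/
theorem dvd_derivative_sq_of_isSquare_eval {F : Type*} [Field F] [Fintype F]
    (hodd : Odd (Fintype.card F)) (hcard : 6 < Fintype.card F) {f : F[X]} (hdeg : f.natDegree ≤ 4)
    (hf : ∀ u, IsSquare (f.eval u) ∧ f.eval u ≠ 0) : f ∣ derivative f ^ 2 := by
  obtain ⟨m, hm⟩ := hodd
  set q := Fintype.card F with hq
  have hq0 : (q : F[X]) = 0 := by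
    rw [← map_natCast (C : F →+* F[X]), hq, FiniteField.cast_card_eq_zero, map_zero]
  have hmon : (X ^ q - X : F[X]).Monic :=
    monic_X_pow_sub (by rw [degree_X]; exact_mod_cast (by omega : 1 < q))
  have hwd : (X ^ q - X : F[X]).natDegree = q :=
    FiniteField.X_pow_card_sub_X_natDegree_eq F Fintype.one_lt_card
  have hw' : derivative (X ^ q - X : F[X]) = -1 := by
    simp [derivative_X_pow, hq]
  obtain ⟨g, hg⟩ : (X ^ q - X : F[X]) ∣ f ^ m - 1 := by
    refine X_pow_card_sub_X_dvd fun u => ?_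
    obtain ⟨⟨r, hr⟩, h0⟩ := hf u
    have hr0 : r ≠ 0 := by rintro rfl; simp_all
    have := FiniteField.pow_card_sub_one_eq_one r hr0
    rw [eval_sub, eval_pow, hr, eval_one, ← pow_two, ← pow_mul, sub_eq_zero, ← this]
    congr 1; omega
  generalize hw : (X ^ q - X : F[X]) = w at *
  have hcof : ∀ {p : F[X]} {n : ℕ}, (w * p).natDegree ≤ q + n → p.natDegree ≤ n := by
    intro p n h
    rcases eq_or_ne p 0 with rfl | hp
    · simp
    · rw [hmon.natDegree_mul' hp, hwd] at h; omega
  have hgd : g.natDegree ≤ q - 2 := by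
    apply hcof
    rw [← hg]
    refine (natDegree_sub_le _ _).trans ?_
    rw [natDegree_one]
    refine max_le (natDegree_pow_le.trans ?_) (by omega)
    calc m * f.natDegree ≤ m * 4 := by gcongr
      _ ≤ _ := by omega
  have hmq : (2 * m + 1 : F[X]) = 0 := by rw [← hq0, hm]; push_cast; ring
  have hd1 := congrArg derivative hg
  rw [derivative_sub, derivative_pow, derivative_one, derivative_mul, hw'] at hd1
  have hm1 : m ≠ 0 := by omega
  have hfm : f * f ^ (m - 1) = f ^ m := by rw [← pow_succ']; congr 1; omega
  simp only [map_natCast] at hd1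
  set f' := derivative f with hf'
  set g' := derivative g with hg'
  have e1 : w * (2 * f * g' + f' * g) = 2 * f * g - f' := by
    linear_combination -2 * f * hd1 + 2 * m * f' * hfm - f' * hg + f' * f ^ m * hmq
  generalize hh : 2 * f * g' + f' * g = h at e1
  have hf'd : f'.natDegree ≤ 3 := (natDegree_derivative_le f).trans (by omega)
  have h2 : (2 : F[X]).natDegree = 0 := natDegree_ofNat 2
  have h4 : (4 : F[X]).natDegree = 0 := natDegree_ofNat 4
  have hhd : h.natDegree ≤ 2 := by
    apply hcof
    rw [e1]
    refine (natDegree_sub_le_of_le (m := q + 2) (n := q + 2) ?_ (by omega)).trans (by simp)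
    refine (natDegree_mul_le_of_le (natDegree_mul_le_of_le h2.le hdeg) hgd).trans (by omega)
  have hd2 := congrArg derivative e1
  simp only [derivative_mul, derivative_sub, hw', derivative_ofNat] at hd2
  rw [← hf', ← hg'] at hd2
  set h' := derivative h with hh'
  set f'' := derivative f' with hf''
  have e2 : w * (2 * f * h' - f' * h) = f' ^ 2 - 2 * f * f'' + 4 * f * h := by
    linear_combination 2 * f * hd2 - f' * e1 + 2 * f * hh
  have hf''d : f''.natDegree ≤ 2 := (natDegree_derivative_le f').trans (by omega)
  have hz : 2 * f * h' - f' * h = 0 := by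
    by_contra hne
    have hle : (w * (2 * f * h' - f' * h)).natDegree ≤ 6 := by
      rw [e2]
      refine natDegree_add_le_of_degree_le
        (natDegree_sub_le_of_le (m := 6) (n := 6) ?_ ?_ |>.trans (by simp)) ?_
      · exact natDegree_pow_le_of_le 2 hf'd
      · exact natDegree_mul_le_of_le (natDegree_mul_le_of_le h2.le hdeg) hf''d
      · exact natDegree_mul_le_of_le (natDegree_mul_le_of_le h4.le hdeg) hhd
    rw [hmon.natDegree_mul' hne, hwd] at hle
    omega
  exact ⟨2 * f'' - 4 * h, by linear_combination w * hz - e2⟩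

/-- If an even quartic takes only nonzero square values on `ℙ¹` of a finite field of odd
cardinality, then its discriminant as a quadratic form in the squares vanishes. -/
theorem discrim_eq_zero_of_isSquare_eval {F : Type*} [Field F] [Fintype F]
    (hodd : Odd (Fintype.card F)) {a b c : F} (ha : IsSquare a) (ha0 : a ≠ 0)
    (hf : ∀ u, IsSquare (a * u ^ 4 + b * u ^ 2 + c) ∧ a * u ^ 4 + b * u ^ 2 + c ≠ 0) :
    b ^ 2 = 4 * a * c := by
  have h2 := two_ne_zero_of_odd_card hodd
  have hsq : ∀ {x : F}, IsSquare x ∧ x ≠ 0 → x ^ (Fintype.card F / 2) = 1 := by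
    rintro _ ⟨⟨r, rfl⟩, h0⟩
    have := FiniteField.pow_card_sub_one_eq_one r (left_ne_zero_of_mul h0)
    rw [← pow_two, ← pow_mul, ← this]
    congr 1
    obtain ⟨m, hm⟩ := hodd
    omega
  have hc : IsSquare c ∧ c ≠ 0 := by simpa using hf 0
  have hq0 := FiniteField.cast_card_eq_zero F
  obtain h3 | h5 | h7 : Fintype.card F = 3 ∨ Fintype.card F = 5 ∨ 6 < Fintype.card F := by
    have := Fintype.one_lt_card (α := F)
    obtain ⟨m, hm⟩ := hodd
    omega
  · rw [h3] at hsq hq0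
    have e1 := hsq ⟨ha, ha0⟩
    have e2 := hsq hc
    have e3 := hsq (hf 1)
    norm_num at e1 e2 e3 hq0
    subst e1 e2
    obtain rfl : b = -1 := by linear_combination e3
    linear_combination -hq0
  · rw [h5] at hsq hq0
    have e1 : a ^ 2 = 1 := hsq ⟨ha, ha0⟩
    have e2 : c ^ 2 = 1 := hsq hc
    have e3 : (a * 1 ^ 4 + b * 1 ^ 2 + c) ^ 2 = 1 := hsq (hf 1)
    have e4 : (a * 2 ^ 4 + b * 2 ^ 2 + c) ^ 2 = 1 := hsq (hf 2)
    push_cast at hq0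
    have e5 : 2 ^ 2 * (b * (a + c)) = 0 := by
      linear_combination e3 - e4 + hq0 * (3 * a + b) * (2 * (a - b + c) + 5 * (3 * a + b))
    rcases mul_eq_zero.1 ((mul_eq_zero.1 e5).resolve_left (pow_ne_zero 2 h2)) with rfl | h
    · have e6 : 2 * a * c + 1 = 0 := by linear_combination e3 - e1 - e2
      linear_combination -2 * e6 + hq0 - (2 * a * c - 1) * e6 + 4 * c ^ 2 * e1 + 4 * e2
    · obtain rfl : c = -a := by linear_combination h
      linear_combination e3 + 4 * e1 + hq0
  · let f : F[X] := C a * X ^ 4 + C b * X ^ 2 + C c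
    have hev : ∀ u, f.eval u = a * u ^ 4 + b * u ^ 2 + c := fun u => by simp [f]
    have hdeg : f.natDegree = 4 := by simp only [f]; compute_degree!
    have hdvd := dvd_derivative_sq_of_isSquare_eval hodd h7 hdeg.le fun u => by
      rw [hev]; exact hf u
    have hd : derivative f = C 2 * (X * (C (2 * a) * X ^ 2 + C b)) := by
      simp [f]
      rw [show (C 3 : F[X]) = 3 from rfl, show (C 2 : F[X]) = 2 from rfl]; ring
    have hfX : IsCoprime f X :=
      ⟨C c⁻¹, -C c⁻¹ * (C a * X ^ 3 + C b * X), by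
        have : C c⁻¹ * C c = (1 : F[X]) := by rw [← C_mul, inv_mul_cancel₀ hc.2, C_1]
        simp only [f]
        linear_combination this⟩
    have hf2 : IsCoprime f (C 2) :=
      ⟨0, C 2⁻¹, by rw [zero_mul, zero_add, ← C_mul, inv_mul_cancel₀ h2, C_1]⟩
    rw [hd, mul_pow, mul_pow] at hdvd
    have hdvd := hfX.pow_right.dvd_of_dvd_mul_left (hf2.pow_right.dvd_of_dvd_mul_left hdvd)
    have hconst : f ∣ C (b ^ 2 - 4 * a * c) := by
      have : C (b ^ 2 - 4 * a * c) = (C (2 * a) * X ^ 2 + C b) ^ 2 - f * C (4 * a) := by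
        simp [f]
        rw [show (C 4 : F[X]) = 4 from rfl, show (C 2 : F[X]) = 2 from rfl]; ring
      rw [this]
      exact dvd_sub hdvd (dvd_mul_right _ _)
    by_contra hne
    have := natDegree_le_of_dvd hconst (C_ne_zero.2 (sub_ne_zero.2 hne))
    rw [hdeg, natDegree_C] at this
    omega

end Quartic

section Coordinates

variable {F : Type*} [Field F] {d A B C D : F}

/-- The form `A x² + B x x̄ - C y² - D y ȳ` over `F(√d)` is anisotropic, expressed in the coordinates
`x = x₁ + x₂ √d`, `y = y₁ + y₂ √d`. -/
def AnisotropicInCoords (d A B C D : F) : Prop :=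
  ∀ x₁ x₂ y₁ y₂ : F, A * x₁ * x₂ = C * y₁ * y₂ →
    (A + B) * x₁ ^ 2 + d * (A - B) * x₂ ^ 2 = (C + D) * y₁ ^ 2 + d * (C - D) * y₂ ^ 2 →
    x₁ = 0 ∧ x₂ = 0 ∧ y₁ = 0 ∧ y₂ = 0

theorem not_isSquare_mul_of_isSquare {a b : F} (ha : ¬IsSquare a) (hb : IsSquare b) (hb0 : b ≠ 0) :
    ¬IsSquare (a * b) := fun h => ha <| by
  simpa [hb0] using h.div hb

theorem isSquare_mul_of_not_isSquare [Fintype F] {a b : F} (ha : ¬IsSquare a) (hb : ¬IsSquare b) :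
    IsSquare (a * b) := by
  classical
  have ha0 : a ≠ 0 := fun h => ha (h ▸ IsSquare.zero)
  have hb0 : b ≠ 0 := fun h => hb (h ▸ IsSquare.zero)
  rw [← quadraticChar_one_iff_isSquare (mul_ne_zero ha0 hb0), map_mul,
    quadraticChar_neg_one_iff_not_isSquare.2 ha, quadraticChar_neg_one_iff_not_isSquare.2 hb]
  rfl

theorem eq_zero_of_mul_sq_eq_mul_sq {P R x y : F} (h : ¬IsSquare (P * R))
    (hxy : P * x ^ 2 = R * y ^ 2) : x = 0 ∧ y = 0 := by
  have hPR : P * R ≠ 0 := fun h0 => h (h0 ▸ IsSquare.zero)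
  have hy : y = 0 := by
    by_contra hy
    refine h ⟨P * x / y, ?_⟩
    field_simp
    linear_combination -P * hxy
  subst hy
  simpa [left_ne_zero_of_mul hPR] using hxy

theorem exists_mul_sq_eq_mul_sq {P R : F} (h : IsSquare (P * R)) :
    ∃ x y : F, P * x ^ 2 = R * y ^ 2 ∧ ¬(x = 0 ∧ y = 0) := by
  obtain ⟨r, hr⟩ := h
  by_cases hP : P = 0
  · exact ⟨1, 0, by simp [hP], by simp⟩
  · exact ⟨r, P, by linear_combination -P * hr, by simp [hP]⟩

theorem anisotropicInCoords_twist_iff (hd : d ≠ 0) :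
    AnisotropicInCoords d A B (d * C) (-(d * D)) ↔ AnisotropicInCoords d A B C D := by
  constructor
  · intro h x₁ x₂ y₁ y₂ h₁ h₂
    obtain ⟨hx₁, hx₂, hy₂, hy₁⟩ := h x₁ x₂ y₂ (y₁ / d) (by field_simp; linear_combination h₁)
      (by field_simp; linear_combination h₂)
    exact ⟨hx₁, hx₂, by simpa [hd] using hy₁, hy₂⟩
  · intro h x₁ x₂ y₁ y₂ h₁ h₂
    obtain ⟨hx₁, hx₂, hy₂, hy₁⟩ := h x₁ x₂ (d * y₂) y₁ (by linear_combination h₁)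
      (by linear_combination h₂)
    exact ⟨hx₁, hx₂, hy₁, by simpa [hd] using hy₂⟩

theorem anisotropicInCoords_of_isSquare (hd : ¬IsSquare d) (hAC : A * C ≠ 0)
    (hsq : IsSquare (A * C)) (hN : ¬IsSquare (A ^ 2 - B ^ 2)) (hD : A * D = -(B * C)) :
    AnisotropicInCoords d A B C D := by
  intro x₁ x₂ y₁ y₂ h₁ h₂
  have hA := left_ne_zero_of_mul hAC
  have hC := right_ne_zero_of_mul hAC
  have hd0 : d ≠ 0 := fun h => hd (h ▸ IsSquare.zero)
  have hN0 : (A + B) * (A - B) ≠ 0 := fun h => hN ⟨0, by linear_combination h⟩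
  have hdAC := not_isSquare_mul_of_isSquare hd hsq hAC
  have hNAC := not_isSquare_mul_of_isSquare hN hsq hAC
  have h₃ : (A + B) * (A * x₁ ^ 2 - d * C * y₂ ^ 2) +
      (A - B) * (d * A * x₂ ^ 2 - C * y₁ ^ 2) = 0 := by
    linear_combination A * h₂ + (y₁ ^ 2 - d * y₂ ^ 2) * hD
  by_cases hx : x₁ = 0
  · subst hx
    have hy : y₁ = 0 ∨ y₂ = 0 := by
      simpa [hC] using h₁.symm
    rcases hy with rfl | rfl
    · have := eq_zero_of_mul_sq_eq_mul_sq (P := (A - B) * A) (R := (A + B) * C) (x := x₂) (y := y₂)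
        (by convert hNAC using 2; ring)
        (mul_left_cancel₀ hd0 (by linear_combination h₃))
      simp [this]
    · have := eq_zero_of_mul_sq_eq_mul_sq (P := d * A) (R := C) (x := x₂) (y := y₁)
        (by rwa [mul_assoc])
        (mul_left_cancel₀ (right_ne_zero_of_mul hN0) (by linear_combination h₃))
      simp [this]
  · exfalso
    have h₄ : (A * x₁ ^ 2 - d * C * y₂ ^ 2) *
        ((A + B) * A * x₁ ^ 2 - (A - B) * C * y₁ ^ 2) = 0 := by
      linear_combination A * x₁ ^ 2 * h₃ -
        (A - B) * d * (A * x₁ * x₂ + C * y₁ * y₂) * h₁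
    rcases mul_eq_zero.1 h₄ with h | h
    · exact hx (eq_zero_of_mul_sq_eq_mul_sq (P := A) (R := d * C) (x := x₁) (y := y₂)
        (by convert hdAC using 2; ring) (by linear_combination h)).1
    · exact hx (eq_zero_of_mul_sq_eq_mul_sq (P := (A + B) * A) (R := (A - B) * C) (x := x₁) (y := y₁)
        (by convert hNAC using 2; ring) (by linear_combination h)).1

variable [Fintype F]

theorem exists_eq_sq_sub_mul_sq (hodd : Odd (Fintype.card F)) (hd : d ≠ 0) (e : F) :
    ∃ x y : F, e = x ^ 2 - d * y ^ 2 := by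
  open Polynomial in
  obtain ⟨x, y, h⟩ := FiniteField.exists_root_sum_quadratic (f := (X ^ 2 - C e : F[X]))
    (g := C (-d) * X ^ 2) (degree_X_pow_sub_C two_pos e)
    (degree_C_mul_X_pow 2 (neg_ne_zero.2 hd)) (Nat.odd_iff.1 hodd)
  simp at h
  exact ⟨x, y, by linear_combination -h⟩

theorem AnisotropicInCoords.mul_ne_zero (hodd : Odd (Fintype.card F)) (hd : d ≠ 0)
    (h : AnisotropicInCoords d A B C D) : A * C ≠ 0 := by
  intro hAC
  rcases mul_eq_zero.1 hAC with rfl | rfl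
  · by_cases hB : B = 0
    · simpa using h 1 0 0 0 (by simp) (by simp [hB])
    · obtain ⟨x₁, x₂, hx⟩ := exists_eq_sq_sub_mul_sq hodd hd ((C + D) / B)
      have := h x₁ x₂ 1 0 (by simp) (by field_simp at hx; linear_combination -hx)
      simp at this
  · by_cases hD : D = 0
    · simpa using h 0 0 1 0 (by simp) (by simp [hD])
    · obtain ⟨y₁, y₂, hy⟩ := exists_eq_sq_sub_mul_sq hodd hd ((A + B) / D)
      have := h 1 0 y₁ y₂ (by simp) (by field_simp at hy; linear_combination hy)
      simp at this

theorem AnisotropicInCoords.isSquare_mul (hd : ¬IsSquare d) (hA : A ≠ 0) (hC : C ≠ 0)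
    (h : AnisotropicInCoords d A B C D) {u v : F} (huv : ¬(u = 0 ∧ v = 0)) :
    IsSquare (((A + B) * C ^ 2 * u ^ 2 - (C + D) * A ^ 2 * v ^ 2) *
      ((C - D) * u ^ 2 - (A - B) * v ^ 2)) ∧
    ((A + B) * C ^ 2 * u ^ 2 - (C + D) * A ^ 2 * v ^ 2) *
      ((C - D) * u ^ 2 - (A - B) * v ^ 2) ≠ 0 := by
  generalize hG₁ : (A + B) * C ^ 2 * u ^ 2 - (C + D) * A ^ 2 * v ^ 2 = G₁
  generalize hG₂ : (C - D) * u ^ 2 - (A - B) * v ^ 2 = G₂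
  have h₁ : G₁ ≠ 0 := by
    rintro rfl
    have := h (C * u) 0 (A * v) 0 (by simp) (by linear_combination hG₁)
    simp [hA, hC] at this
    exact huv this
  have h₂ : G₂ ≠ 0 := by
    rintro rfl
    have := h 0 v 0 u (by simp) (by linear_combination -d * hG₂)
    simp at this
    exact huv this.symm
  refine ⟨?_, _root_.mul_ne_zero h₁ h₂⟩
  by_contra hns
  obtain ⟨w, hw⟩ := isSquare_mul_of_not_isSquare hd hns
  have := h (C * w * u) (G₁ * v) (A * w * v) (G₁ * u) (by ring)
    (by linear_combination w ^ 2 * hG₁ - d * G₁ ^ 2 * hG₂ - G₁ * hw)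
  simp [h₁] at this
  exact huv ⟨this.2.2.2, this.2.1⟩

theorem AnisotropicInCoords.of_isSquare (hodd : Odd (Fintype.card F)) (hd : ¬IsSquare d)
    (hAC : A * C ≠ 0) (hsq : IsSquare (A * C)) (h : AnisotropicInCoords d A B C D) :
    A * D = -(B * C) ∧ ¬IsSquare (A ^ 2 - B ^ 2) := by
  have hA := left_ne_zero_of_mul hAC
  have hC := right_ne_zero_of_mul hAC
  have hd0 : d ≠ 0 := fun h => hd (h ▸ IsSquare.zero)
  have hlead := h.isSquare_mul hd hA hC (u := 1) (v := 0) (by simp)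
  have hdisc := discrim_eq_zero_of_isSquare_eval hodd
    (a := (A + B) * C ^ 2 * (C - D))
    (b := -((A + B) * C ^ 2 * (A - B) + (C + D) * A ^ 2 * (C - D)))
    (c := (C + D) * A ^ 2 * (A - B)) (by simpa using hlead.1) (by simpa using hlead.2) fun u => by
      have := h.isSquare_mul hd hA hC (u := u) (v := 1) (by simp)
      rwa [show ((A + B) * C ^ 2 * u ^ 2 - (C + D) * A ^ 2 * 1 ^ 2) *
          ((C - D) * u ^ 2 - (A - B) * 1 ^ 2) = (A + B) * C ^ 2 * (C - D) * u ^ 4 +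
          -((A + B) * C ^ 2 * (A - B) + (C + D) * A ^ 2 * (C - D)) * u ^ 2 +
          (C + D) * A ^ 2 * (A - B) by ring] at this
  have hprod : (A * D - B * C) * (A * D + B * C) = 0 := by
    refine pow_eq_zero_iff two_ne_zero |>.1 ?_
    linear_combination hdisc
  have hD : A * D = -(B * C) := by
    refine (mul_eq_zero.1 hprod).elim (fun h₀ => ?_) fun h₀ => by linear_combination h₀
    obtain ⟨x, y, hxy, h0⟩ := exists_mul_sq_eq_mul_sq hsq
    have := h x 0 y 0 (by simp)
      (mul_left_cancel₀ hA (by linear_combination (A + B) * hxy - y ^ 2 * h₀))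
    exact absurd ⟨this.1, this.2.2.1⟩ h0
  refine ⟨hD, fun hN => ?_⟩
  obtain ⟨x, y, hxy, h0⟩ := exists_mul_sq_eq_mul_sq (P := (A - B) * A) (R := (A + B) * C)
    (by
      rw [show (A - B) * A * ((A + B) * C) = (A ^ 2 - B ^ 2) * (A * C) by ring]
      exact hN.mul hsq)
  have := h 0 x 0 y (by simp)
    (mul_left_cancel₀ hA (by linear_combination d * hxy + d * y ^ 2 * hD))
  exact h0 ⟨this.2.1, this.2.2.2⟩

theorem anisotropicInCoords_iff (hodd : Odd (Fintype.card F)) (hd : ¬IsSquare d) :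
    AnisotropicInCoords d A B C D ↔ A * C ≠ 0 ∧ ¬IsSquare (A ^ 2 - B ^ 2) ∧
      (IsSquare (A * C) → A * D = -(B * C)) ∧ (¬IsSquare (A * C) → A * D = B * C) := by
  have hd0 : d ≠ 0 := fun h => hd (h ▸ IsSquare.zero)
  by_cases hsq : IsSquare (A * C)
  · simp only [hsq, not_true_eq_false, false_imp_iff, and_true, true_imp_iff]
    constructor
    · intro h
      have hAC := h.mul_ne_zero hodd hd0
      exact ⟨hAC, (h.of_isSquare hodd hd hAC hsq).symm⟩
    · rintro ⟨hAC, hN, hD⟩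
      exact anisotropicInCoords_of_isSquare hd hAC hsq hN hD
  · simp only [hsq, not_false_eq_true, false_imp_iff, true_and, true_imp_iff]
    have hsq' : IsSquare (A * (d * C)) := by
      rw [mul_left_comm]; exact isSquare_mul_of_not_isSquare hd hsq
    rw [← anisotropicInCoords_twist_iff hd0]
    constructor
    · intro h
      have hAC := h.mul_ne_zero hodd hd0
      obtain ⟨hD, hN⟩ := h.of_isSquare hodd hd hAC hsq'
      refine ⟨fun h0 => hAC (by linear_combination d * h0), hN, mul_left_cancel₀ hd0 ?_⟩
      linear_combination -hD
    · rintro ⟨hAC, hN, hD⟩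
      refine anisotropicInCoords_of_isSquare hd ?_ hsq' hN (by linear_combination -d * hD)
      rw [mul_left_comm]
      exact _root_.mul_ne_zero hd0 hAC

end Coordinates

section Extension

variable {K L : Type*} [Field K] [Field L] [Algebra K L]

theorem exists_sqrt_generator (h2 : (2 : K) ≠ 0) (hquad : finrank K L = 2) (σ : L ≃ₐ[K] L)
    (hσ : ∃ x, σ x ≠ x) :
    ∃ (d : K) (δ : L), ¬IsSquare d ∧ δ ^ 2 = algebraMap K L d ∧ σ δ = -δ ∧
      (∀ x, ∃ p r, x = algebraMap K L p + algebraMap K L r * δ) ∧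
      ∀ p r, algebraMap K L p + algebraMap K L r * δ = 0 → p = 0 ∧ r = 0 := by
  obtain ⟨x, hx⟩ := hσ
  have hfix : ∀ {y : L}, σ y ≠ y → ∀ p, algebraMap K L p ≠ y := by
    rintro _ hy p rfl
    simp at hy
  have hind : ∀ {y : L}, σ y ≠ y → ∀ p r, algebraMap K L p + algebraMap K L r * y = 0 →
      p = 0 ∧ r = 0 := by
    intro y hy p r h
    have hr : r = 0 := by
      by_contra hr
      refine hfix hy (-p / r) ?_
      have : algebraMap K L r ≠ 0 := by simpa using hr
      rw [map_div₀, map_neg]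
      field_simp
      linear_combination -h
    subst hr
    simpa using h
  have hspan : ∀ {y : L}, σ y ≠ y → ∀ z, ∃ p r, z = algebraMap K L p + algebraMap K L r * y := by
    intro y hy z
    have hli : LinearIndependent K ![1, y] := LinearIndependent.pair_iff.2 fun p r h =>
      hind hy p r (by simpa [Algebra.smul_def] using h)
    have hz : z ∈ Submodule.span K (Set.range ![1, y]) := by
      rw [hli.span_eq_top_of_card_eq_finrank (by simp [hquad])]
      trivial
    rw [Matrix.range_cons_cons_empty, Submodule.mem_span_pair] at hz
    obtain ⟨p, r, h⟩ := hz
    exact ⟨p, r, by simpa [Algebra.smul_def] using h.symm⟩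
  obtain ⟨p, r, hpr⟩ := hspan hx (x ^ 2)
  have h2L : (2 : L) ≠ 0 := by
    rw [← map_ofNat (algebraMap K L) 2]
    exact (map_ne_zero _).2 h2
  have hδ : σ (2 * x - algebraMap K L r) ≠ 2 * x - algebraMap K L r := by
    rw [map_sub, map_mul, map_ofNat, AlgEquiv.commutes]
    simpa [h2L] using hx
  have hsq : (2 * x - algebraMap K L r) ^ 2 = algebraMap K L (4 * p + r ^ 2) := by
    simp only [map_add, map_mul, map_pow, map_ofNat]
    linear_combination 4 * hpr
  generalize 2 * x - algebraMap K L r = δ at hδ hsq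
  refine ⟨4 * p + r ^ 2, δ, ?_, hsq, ?_, hspan hδ, hind hδ⟩
  · rintro ⟨e, he⟩
    rw [he, map_mul, ← pow_two, sq_eq_sq_iff_eq_or_eq_neg] at hsq
    rcases hsq with h | h
    · exact hfix hδ e h.symm
    · exact hfix hδ (-e) (by rw [map_neg, h])
  · refine (sq_eq_sq_iff_eq_or_eq_neg.1 ?_).resolve_left hδ
    rw [← map_pow, hsq, AlgEquiv.commutes]

theorem anisotropic_iff_anisotropicInCoords (h2 : (2 : K) ≠ 0) {σ : L ≃ₐ[K] L} {d : K} {δ : L}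
    (hδ : δ ^ 2 = algebraMap K L d) (hσδ : σ δ = -δ)
    (hspan : ∀ x, ∃ p r, x = algebraMap K L p + algebraMap K L r * δ)
    (hind : ∀ p r, algebraMap K L p + algebraMap K L r * δ = 0 → p = 0 ∧ r = 0) (A B C D : K) :
    (∀ x y : L, algebraMap K L A * x ^ 2 + algebraMap K L B * (x * σ x) -
      algebraMap K L C * y ^ 2 - algebraMap K L D * (y * σ y) = 0 → x = 0 ∧ y = 0) ↔
      AnisotropicInCoords d A B C D := by
  have key : ∀ x₁ x₂ y₁ y₂ : K,
      algebraMap K L A * (algebraMap K L x₁ + algebraMap K L x₂ * δ) ^ 2 +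
        algebraMap K L B * ((algebraMap K L x₁ + algebraMap K L x₂ * δ) *
          σ (algebraMap K L x₁ + algebraMap K L x₂ * δ)) -
        algebraMap K L C * (algebraMap K L y₁ + algebraMap K L y₂ * δ) ^ 2 -
        algebraMap K L D * ((algebraMap K L y₁ + algebraMap K L y₂ * δ) *
          σ (algebraMap K L y₁ + algebraMap K L y₂ * δ)) =
      algebraMap K L ((A + B) * x₁ ^ 2 + d * (A - B) * x₂ ^ 2 -
          ((C + D) * y₁ ^ 2 + d * (C - D) * y₂ ^ 2)) +
        algebraMap K L (2 * (A * x₁ * x₂ - C * y₁ * y₂)) * δ := by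
    intro x₁ x₂ y₁ y₂
    simp only [map_add, map_sub, map_mul, map_pow, map_ofNat, AlgEquiv.commutes, hσδ, ← hδ]
    ring
  constructor
  · intro h x₁ x₂ y₁ y₂ h₁ h₂
    obtain ⟨hx, hy⟩ := h _ _ ((key x₁ x₂ y₁ y₂).trans (by simp [h₁, h₂]))
    exact ⟨(hind _ _ hx).1, (hind _ _ hx).2, (hind _ _ hy).1, (hind _ _ hy).2⟩
  · intro h x y hxy
    obtain ⟨x₁, x₂, rfl⟩ := hspan x
    obtain ⟨y₁, y₂, rfl⟩ := hspan y
    rw [key] at hxy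
    obtain ⟨h₂, h₁⟩ := hind _ _ hxy
    obtain ⟨rfl, rfl, rfl, rfl⟩ := h x₁ x₂ y₁ y₂
      (sub_eq_zero.1 ((mul_eq_zero.1 h₁).resolve_left h2)) (sub_eq_zero.1 h₂)
    simp

end Extension

theorem absk_of_isSquare [Field k] {x : k} (h : IsSquare x) : absk x = x := if_pos h

theorem absk_of_not_isSquare [Field k] {x : k} (h : ¬IsSquare x) : absk x = -x := if_neg h

theorem absk_ne_zero [Field k] {x : k} (h : x ≠ 0) : absk x ≠ 0 := by
  unfold absk
  split_ifs
  exacts [h, neg_ne_zero.2 h]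

theorem absk_mul [Field k] [Fintype k] (x y : k) : absk (x * y) = absk x * absk y := by
  by_cases hx0 : x = 0
  · simp [hx0, absk]
  by_cases hy0 : y = 0
  · simp [hy0, absk]
  by_cases hx : IsSquare x <;> by_cases hy : IsSquare y
  · rw [absk_of_isSquare hx, absk_of_isSquare hy, absk_of_isSquare (hx.mul hy)]
  · rw [absk_of_isSquare hx, absk_of_not_isSquare hy, mul_comm x,
      absk_of_not_isSquare (not_isSquare_mul_of_isSquare hy hx hx0)]
    ring
  · rw [absk_of_not_isSquare hx, absk_of_isSquare hy,
      absk_of_not_isSquare (not_isSquare_mul_of_isSquare hx hy hy0)]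
    ring
  · rw [absk_of_not_isSquare hx, absk_of_not_isSquare hy,
      absk_of_isSquare (isSquare_mul_of_not_isSquare hx hy)]
    ring

theorem absk_sq [Field k] (x : k) : absk x ^ 2 = x ^ 2 := by
  unfold absk
  split_ifs <;> ring

/-- Let `k` be a finite field of odd cardinality and `ℓ/k` its quadratic
field extension with nontrivial `k`-automorphism `σ`. Then:
(i) a pair `(a, b) ∈ k²` is `ℓ`-admissible iff `a = b` and `1 − a²` is not a square in `k`;
(ii) a triple `c = (c₁, c₂, c₃) ∈ k³` is `ℓ`-admissible iff `(1 − c₁)c₂ ≠ 0`, `1 − 2c₁` is not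
a square in `k`, and `c₃ = −c₁|c₂| / |1 − c₁|`. -/
theorem finite_field_admissibility [Field k] [Fintype k] (hodd : Odd (Fintype.card k))
    [Field ℓ] [Algebra k ℓ] (hquad : finrank k ℓ = 2)
    (σ : ℓ ≃ₐ[k] ℓ) (hσ : ∃ x : ℓ, σ x ≠ x) :
    -- (i)
    (∀ a b : k, IsAdmissiblePair σ a b ↔ (a = b ∧ ¬ IsSquare (1 - a ^ 2))) ∧
    -- (ii)
    (∀ c : k × k × k, IsAdmissibleTriple σ c ↔
      ((1 - c.1) * c.2.1 ≠ 0 ∧ ¬ IsSquare (1 - 2 * c.1) ∧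
        c.2.2 = -c.1 * absk c.2.1 / absk (1 - c.1))) := by
  have h2 := two_ne_zero_of_odd_card hodd
  obtain ⟨d, δ, hd, hδ, hσδ, hspan, hind⟩ := exists_sqrt_generator h2 hquad σ hσ
  have key (A B C D : k) := (anisotropic_iff_anisotropicInCoords h2 hδ hσδ hspan hind A B C D).trans
    (anisotropicInCoords_iff hodd hd)
  refine ⟨fun a b => ?_, fun ⟨c₁, c₂, c₃⟩ => ?_⟩
  · refine Iff.trans (forall₂_congr fun x y => ?_) ((key 1 a 1 (-b)).trans ?_)
    · rw [hab, map_one, map_neg]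
      ring_nf
    simp [and_comm, eq_comm]
  · refine Iff.trans (forall₂_congr fun x y => ?_) ((key (1 - c₁) c₁ c₂ c₃).trans ?_)
    · rw [qc, map_sub, map_one]
    rw [show (1 - c₁) ^ 2 - c₁ ^ 2 = 1 - 2 * c₁ by ring]
    refine and_congr_right fun h0 => and_congr_right fun _ => ?_
    have hA := left_ne_zero_of_mul h0
    have habs := absk_mul (1 - c₁) c₂
    have hsq := absk_sq (1 - c₁)
    dsimp only
    rw [eq_div_iff (absk_ne_zero hA)]
    have hmul : c₃ * absk (1 - c₁) = -c₁ * absk c₂ ↔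
        (1 - c₁) * ((1 - c₁) * c₃) = -c₁ * absk ((1 - c₁) * c₂) := by
      rw [habs, ← mul_left_inj' (absk_ne_zero hA)]
      constructor <;> intro h
      · linear_combination h - c₃ * hsq
      · linear_combination h + c₃ * hsq
    rw [hmul]
    by_cases hs : IsSquare ((1 - c₁) * c₂)
    · simp only [hs, not_true_eq_false, false_imp_iff, and_true, true_imp_iff, absk_of_isSquare hs]
      rw [← mul_right_inj' hA]
      ring_nf
    · simp only [hs, not_false_eq_true, false_imp_iff, true_and, true_imp_iff,
        absk_of_not_isSquare hs]
      rw [← mul_right_inj' hA]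
      ring_nf
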